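/- Let G be a groupoid, Γ a commutative group with neutral element 1, and δ : Γ → (G → G), ε ↦ δ_ε, a family of maps satisfying α(δ_ε g) = α(g), δ_ε(δ_μ g) = δ_{εμ} g, δ_1 = id, and δ_ε(e(x)) = e(x) for every object x. For arrows g, h with α(g) = α(h) define the dilatation δ_ε^h g = δ_ε(gh⁻¹)h, the approximate difference dif_ε(g, h) = δ_{ε⁻¹}(δ_ε(g)(δ_ε(h))⁻¹), Δ_ε(g, h) = dif_ε(g, h)·δ_ε(h), and for u, g, h with α(u) = α(g) = α(h) the three-argument approximate difference Δ_ε^u(g, h) = δ_{ε⁻¹}^{δ_ε^u g}(δ_ε^u h). Then for all ε ∈ Γ and all u, g, h with α(u) = α(g) = α(h): Δ_ε(hu⁻¹, gu⁻¹) = Δ_ε^u(g, h)·u⁻¹. -/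

import Mathlib

/-- A groupoid given by its set of objects `X` and set of arrows `G`, with
source `src`, target `tgt`, identity section `unit`, a (total) composition
`comp` whose value is only meaningful when `src g = tgt h`, and inversion
`inv`. -/
structure GroupoidStr (X : Type*) (G : Type*) where
  src : G → X
  tgt : G → X
  unit : X → G
  comp : G → G → G
  inv : G → G
  src_unit : ∀ x, src (unit x) = x
  tgt_unit : ∀ x, tgt (unit x) = x
  src_comp : ∀ g h, src g = tgt h → src (comp g h) = src h
  tgt_comp : ∀ g h, src g = tgt h → tgt (comp g h) = tgt g
  comp_assoc : ∀ g h k, src g = tgt h → src h = tgt k →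
    comp (comp g h) k = comp g (comp h k)
  unit_comp : ∀ g, comp (unit (tgt g)) g = g
  comp_unit : ∀ g, comp g (unit (src g)) = g
  src_inv : ∀ g, src (inv g) = tgt g
  tgt_inv : ∀ g, tgt (inv g) = src g
  inv_comp : ∀ g, comp (inv g) g = unit (src g)
  comp_inv : ∀ g, comp g (inv g) = unit (tgt g)

/-- `d` is a norm on the groupoid `S`. -/
structure IsGroupoidNorm {X G : Type*} (S : GroupoidStr X G) (d : G → ℝ) : Prop where
  nonneg : ∀ g, 0 ≤ d g
  eq_zero_iff : ∀ g, (d g = 0 ↔ ∃ x, g = S.unit x)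
  comp_le : ∀ g h, S.src g = S.tgt h → d (S.comp g h) ≤ d g + d h
  inv_eq : ∀ g, d (S.inv g) = d g

/-- The dilatation based at `h`: `δ_ε^h g = δ_ε (g h⁻¹) h`. -/
def dilat {X G Γ : Type*} (S : GroupoidStr X G) (δ : Γ → G → G)
    (ε : Γ) (h g : G) : G :=
  S.comp (δ ε (S.comp g (S.inv h))) h

/-- The approximate difference `dif_ε (g, h) = δ_{ε⁻¹} (δ_ε g (δ_ε h)⁻¹)`. -/
def difE {X G Γ : Type*} [Group Γ] (S : GroupoidStr X G) (δ : Γ → G → G)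
    (ε : Γ) (g h : G) : G :=
  δ ε⁻¹ (S.comp (δ ε g) (S.inv (δ ε h)))

/-- `Δ_ε (g, h) = dif_ε (g, h) · δ_ε h`. -/
def DeltaE {X G Γ : Type*} [Group Γ] (S : GroupoidStr X G) (δ : Γ → G → G)
    (ε : Γ) (g h : G) : G :=
  S.comp (difE S δ ε g h) (δ ε h)

namespace GroupoidStr

variable {X G : Type*} (S : GroupoidStr X G)

theorem comp_inv_cancel_right {g k : G} (hgk : S.src g = S.tgt k) :
    S.comp (S.comp g k) (S.inv k) = g := by
  rw [S.comp_assoc g k _ hgk (S.tgt_inv k).symm, S.comp_inv, ← hgk, S.comp_unit]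

theorem inv_comp_cancel_right {g k : G} (hgk : S.src g = S.src k) :
    S.comp (S.comp g (S.inv k)) k = g := by
  rw [S.comp_assoc g _ k (hgk.trans (S.tgt_inv k).symm) (S.src_inv k), S.inv_comp, ← hgk,
    S.comp_unit]

theorem comp_right_cancel {g h k : G} (hgk : S.src g = S.tgt k) (hhk : S.src h = S.tgt k)
    (heq : S.comp g k = S.comp h k) : g = h := by
  rw [← S.comp_inv_cancel_right hgk, heq, S.comp_inv_cancel_right hhk]

theorem comp_comp_inv_comp {a b u : G} (ha : S.src a = S.tgt u) (hb : S.src b = S.tgt u) :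
    S.comp (S.comp a u) (S.inv (S.comp b u)) = S.comp a (S.inv b) := by
  have hab : S.src a = S.tgt (S.inv b) := by rw [S.tgt_inv, ha, hb]
  have hau : S.src (S.comp a u) = S.src (S.comp b u) := by
    rw [S.src_comp _ _ ha, S.src_comp _ _ hb]
  have hsrc : S.src (S.comp a (S.inv b)) = S.tgt b := by rw [S.src_comp _ _ hab, S.src_inv]
  apply S.comp_right_cancel (k := S.comp b u)
  · rw [S.src_comp _ _ (hau.trans (S.tgt_inv _).symm), S.src_inv]
  · rw [hsrc, S.tgt_comp _ _ hb]
  · rw [S.inv_comp_cancel_right hau, ← S.comp_assoc _ b u hsrc hb,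
      S.inv_comp_cancel_right (ha.trans hb.symm)]

end GroupoidStr

/-- For a groupoid `S` with a family of maps `δ_ε` (indexed by a commutative
group `Γ`) fixing sources, forming an action and fixing identity arrows, the
approximate difference functions satisfy
`Δ_ε (h u⁻¹, g u⁻¹) = Δ_ε^u (g, h) · u⁻¹`, where
`Δ_ε^u (g, h) = δ_{ε⁻¹}^{δ_ε^u g} (δ_ε^u h)`. -/
theorem approximate_difference_translation {X G Γ : Type*} [CommGroup Γ]
    (S : GroupoidStr X G) (δ : Γ → G → G)
    (hsrc : ∀ (ε : Γ) (g : G), S.src (δ ε g) = S.src g)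
    (haction : ∀ (ε μ : Γ) (g : G), δ ε (δ μ g) = δ (ε * μ) g)
    (hone : ∀ g : G, δ 1 g = g)
    (hunit : ∀ (ε : Γ) (x : X), δ ε (S.unit x) = S.unit x)
    (ε : Γ) (u g h : G)
    (hg : S.src g = S.src u) (hh : S.src h = S.src u) :
    DeltaE S δ ε (S.comp h (S.inv u)) (S.comp g (S.inv u)) =
      S.comp (dilat S δ ε⁻¹ (dilat S δ ε u g) (dilat S δ ε u h)) (S.inv u) := by
  have src_delta {k : G} (hk : S.src k = S.src u) :
      S.src (δ ε (S.comp k (S.inv u))) = S.tgt u := by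
    rw [hsrc, S.src_comp _ _ (hk.trans (S.tgt_inv u).symm), S.src_inv]
  have ha := src_delta hh
  have hb := src_delta hg
  simp only [DeltaE, difE, dilat]
  rw [S.comp_comp_inv_comp ha hb]
  have hc : S.src (δ ε⁻¹ (S.comp (δ ε (S.comp h (S.inv u)))
      (S.inv (δ ε (S.comp g (S.inv u)))))) = S.tgt (δ ε (S.comp g (S.inv u))) := by
    rw [hsrc, S.src_comp _ _ (by rw [S.tgt_inv, ha, hb]), S.src_inv]
  rw [← S.comp_assoc _ _ u hc hb, S.comp_inv_cancel_right]
  rw [S.src_comp _ _ hc, hb]
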